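/- For every tree-like OCATA A over alphabet Σ, the dual automaton A^C accepts exactly the complement of the language of A over infinite timed words: L^ω(A^C) = TΣ^ω \ L^ω(A). -/

import Mathlib

namespace OcataPaper

open Set

/-! ### Clock constraints and transition formulas `Γ(L)` -/

inductive Cmp : Type
  | lt | le | gt | ge
deriving DecidableEq

def Cmp.eval : Cmp → ℝ → ℕ → Prop
  | .lt, v, c => v < c
  | .le, v, c => v ≤ c
  | .gt, v, c => v > c
  | .ge, v, c => v ≥ c

def Cmp.negate : Cmp → Cmp
  | .lt => .ge
  | .le => .gt
  | .gt => .le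
  | .ge => .lt

inductive TransFormula (L : Type*) : Type _
  | tt : TransFormula L
  | ff : TransFormula L
  | or (γ₁ γ₂ : TransFormula L) : TransFormula L
  | and (γ₁ γ₂ : TransFormula L) : TransFormula L
  | loc (ℓ : L) : TransFormula L
  | cmp (op : Cmp) (c : ℕ) : TransFormula L
  | reset (γ : TransFormula L) : TransFormula L

/-- The locations occurring in a formula of `Γ(L)`. -/
def TransFormula.locs {L : Type*} : TransFormula L → Set L
  | .tt => ∅
  | .ff => ∅
  | .or γ₁ γ₂ => γ₁.locs ∪ γ₂.locs
  | .and γ₁ γ₂ => γ₁.locs ∪ γ₂.locs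
  | .loc ℓ => {ℓ}
  | .cmp _ _ => ∅
  | .reset γ => γ.locs

/-- The constants occurring in clock constraints of a formula of `Γ(L)`. -/
def TransFormula.consts {L : Type*} : TransFormula L → Set ℕ
  | .tt => ∅
  | .ff => ∅
  | .or γ₁ γ₂ => γ₁.consts ∪ γ₂.consts
  | .and γ₁ γ₂ => γ₁.consts ∪ γ₂.consts
  | .loc _ => ∅
  | .cmp _ c => {c}
  | .reset γ => γ.consts

def TransFormula.map {L L' : Type*} (g : L → L') : TransFormula L → TransFormula L'
  | .tt => .tt
  | .ff => .ff
  | .or γ₁ γ₂ => .or (γ₁.map g) (γ₂.map g)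
  | .and γ₁ γ₂ => .and (γ₁.map g) (γ₂.map g)
  | .loc ℓ => .loc (g ℓ)
  | .cmp op c => .cmp op c
  | .reset γ => .reset (γ.map g)

/-- The dual `γ̄` of a formula of `Γ(L)`. -/
def TransFormula.dual {L : Type*} : TransFormula L → TransFormula L
  | .tt => .ff
  | .ff => .tt
  | .or γ₁ γ₂ => .and γ₁.dual γ₂.dual
  | .and γ₁ γ₂ => .or γ₁.dual γ₂.dual
  | .loc ℓ => .loc ℓ
  | .cmp op c => .cmp op.negate c
  | .reset γ => .reset γ.dual

/-! ### One-clock alternating timed automata -/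

structure OCATA (A : Type*) (L : Type*) where
  init : L
  final : Set L
  δ : L → A → TransFormula L

/-- The dual automaton `A^C`. -/
def OCATA.dual {A L : Type*} (Aut : OCATA A L) : OCATA A L where
  init := Aut.init
  final := Aut.finalᶜ
  δ := fun ℓ σ => (Aut.δ ℓ σ).dual

/-! ### The interval semantics -/

/-- A state of an OCATA in the interval semantics: a location and a clock interval. -/
abbrev OState (L : Type*) := L × Set ℝ

/-- The interval `[0,0]`. -/
def zeroItv : Set ℝ := {0}

/-- `I` is an interval with endpoints in `ℝ⁺`. -/
def IsItv (I : Set ℝ) : Prop :=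
  I.Nonempty ∧ I.OrdConnected ∧ BddAbove I ∧ ∀ x ∈ I, 0 ≤ x

/-- `C(ℓ)`: the intervals associated with location `ℓ` in `C`. -/
def locSet {L : Type*} (C : Set (OState L)) (ℓ : L) : Set (Set ℝ) := {I | (ℓ, I) ∈ C}

/-- Configurations: finite sets of states, intervals of a same location pairwise disjoint. -/
def IsConfig {L : Type*} (C : Set (OState L)) : Prop :=
  C.Finite ∧ (∀ s ∈ C, IsItv s.2) ∧
    ∀ ℓ I J, (ℓ, I) ∈ C → (ℓ, J) ∈ C → I ≠ J → Disjoint I J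

/-- `I + t`. -/
def shiftItv (I : Set ℝ) (t : ℝ) : Set ℝ := (fun x => x + t) '' I

/-- `C + t`. -/
def shiftCfg {L : Type*} (C : Set (OState L)) (t : ℝ) : Set (OState L) :=
  (fun s => (s.1, shiftItv s.2 t)) '' C

/-- The satisfaction relation `M ⊨_I γ`. -/
def Models {L : Type*} (M : Set (OState L)) : TransFormula L → Set ℝ → Prop
  | .tt, _ => True
  | .ff, _ => False
  | .or γ₁ γ₂, I => Models M γ₁ I ∨ Models M γ₂ I
  | .and γ₁ γ₂, I => Models M γ₁ I ∧ Models M γ₂ I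
  | .loc ℓ, I => (ℓ, I) ∈ M
  | .cmp op c, I => ∀ v ∈ I, op.eval v c
  | .reset γ, _ => Models M γ zeroItv

/-- `M` is a minimal model of `γ` w.r.t. `I`. -/
def IsMinModel {L : Type*} (M : Set (OState L)) (γ : TransFormula L) (I : Set ℝ) : Prop :=
  Models M γ I ∧ ∀ M' ⊂ M, ¬ Models M' γ I

/-- `‖E‖`: one clock per singular interval, two per non-singular interval. -/
noncomputable def nbClocks (E : Set (Set ℝ)) : ℕ :=
  ({I ∈ E | ∃ a : ℝ, I = {a}}).ncard + 2 * ({I ∈ E | ¬ ∃ a : ℝ, I = {a}}).ncard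

/-- `‖C‖ = Σ_ℓ ‖C(ℓ)‖`. -/
noncomputable def nbClocksC {L : Type*} (C : Set (OState L)) : ℕ :=
  ({s ∈ C | ∃ a : ℝ, s.2 = {a}}).ncard + 2 * ({s ∈ C | ¬ ∃ a : ℝ, s.2 = {a}}).ncard

/-- Approximation functions. -/
def IsApproxFun {L : Type*} (f : Set (OState L) → Set (Set (OState L))) : Prop :=
  ∀ C, IsConfig C → ∀ C' ∈ f C, IsConfig C' ∧ ∀ ℓ : L,
    nbClocks (locSet C' ℓ) ≤ nbClocks (locSet C ℓ) ∧
    (∀ I ∈ locSet C ℓ, ∃ J ∈ locSet C' ℓ, I ⊆ J) ∧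
    (∀ J ∈ locSet C' ℓ,
      (∃ I₁ ∈ locSet C ℓ, sInf J = sInf I₁) ∧ (∃ I₂ ∈ locSet C ℓ, sSup J = sSup I₂))

/-! ### Infinite timed words -/

/-- An infinite timed word: letters `σ₁σ₂⋯` and a non-decreasing time sequence `τ₁τ₂⋯`
(positions are `≥ 1`; by convention `τ₀ = 0`). -/
structure TimedWord (A : Type*) where
  letter : ℕ → A
  time : ℕ → ℝ
  time_zero : time 0 = 0
  mono : Monotone time

/-! ### `f`-runs (as DAGs, with the chosen minimal models recorded) -/

structure FRun {A L : Type*} (Aut : OCATA A L)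
    (f : Set (OState L) → Set (Set (OState L))) (θ : TimedWord A) where
  config : ℕ → Set (OState L)
  model : ℕ → OState L → Set (OState L)
  init : config 0 = {(Aut.init, zeroItv)}
  isConfig : ∀ i, IsConfig (config i)
  minModel : ∀ i, ∀ s ∈ shiftCfg (config i) (θ.time (i + 1) - θ.time i),
    IsMinModel (model i s) (Aut.δ s.1 (θ.letter (i + 1))) s.2
  succ : ∀ i, config (i + 1) ∈
    f (⋃ s ∈ shiftCfg (config i) (θ.time (i + 1) - θ.time i), model i s)

/-- The edges of the DAG of a run (via `dest`). -/
def FRun.Edge {A L : Type*} {Aut : OCATA A L}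
    {f : Set (OState L) → Set (Set (OState L))} {θ : TimedWord A}
    (ρ : FRun Aut f θ) (i : ℕ) (s s' : OState L) : Prop :=
  s ∈ ρ.config i ∧ s' ∈ ρ.config (i + 1) ∧
  ∃ I, (s'.1, I) ∈ ρ.model i (s.1, shiftItv s.2 (θ.time (i + 1) - θ.time i)) ∧ I ⊆ s'.2

/-- An (infinite) branch of the DAG of a run. -/
def FRun.IsBranch {A L : Type*} {Aut : OCATA A L}
    {f : Set (OState L) → Set (Set (OState L))} {θ : TimedWord A}
    (ρ : FRun Aut f θ) (β : ℕ → OState L) : Prop :=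
  β 0 = (Aut.init, zeroItv) ∧ ∀ i, ρ.Edge i (β i) (β (i + 1))

/-- Büchi acceptance: every infinite branch visits accepting locations infinitely often. -/
def FRun.Accepting {A L : Type*} {Aut : OCATA A L}
    {f : Set (OState L) → Set (Set (OState L))} {θ : TimedWord A}
    (ρ : FRun Aut f θ) : Prop :=
  ∀ β, ρ.IsBranch β → ∀ N, ∃ i, N ≤ i ∧ (β i).1 ∈ Aut.final

/-- The identity approximation function, giving the standard semantics. -/
def IdApprox {L : Type*} : Set (OState L) → Set (Set (OState L)) := fun C => {C}

/-- `L^ω_f(A)`. -/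
def FLang {A L : Type*} (Aut : OCATA A L)
    (f : Set (OState L) → Set (Set (OState L))) : Set (TimedWord A) :=
  {θ | ∃ ρ : FRun Aut f θ, ρ.Accepting}

/-! ### Tree-like OCATA -/

/-- `B ≼ B'` : some location of `B` occurs in `δ(ℓ,σ)` for some `ℓ ∈ B'`. -/
def BlockRel {A L : Type*} (Aut : OCATA A L) (B B' : Set L) : Prop :=
  ∃ σ : A, ∃ ℓ ∈ B', ∃ ℓ' ∈ B, ℓ' ∈ (Aut.δ ℓ σ).locs

/-- Tree-like OCATA: partition of the locations into blocks, each fully accepting or fully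
non-accepting, with the occurrence relation between blocks a partial order
(antisymmetric, and transitive up to reflexivity). -/
def IsTOCATA {A L : Type*} (Aut : OCATA A L) : Prop :=
  ∃ P : Set (Set L), Setoid.IsPartition P ∧
    (∀ B ∈ P, B ⊆ Aut.final ∨ B ∩ Aut.final = ∅) ∧
    (∀ B ∈ P, ∀ B' ∈ P, BlockRel Aut B B' → BlockRel Aut B' B → B = B') ∧
    (∀ B ∈ P, ∀ B' ∈ P, ∀ B'' ∈ P,
      BlockRel Aut B B' → BlockRel Aut B' B'' → B = B'' ∨ BlockRel Aut B B'')


/-! ### MTL / MITL formulas (in negative normal form when `IsNNF` holds) -/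

/-- An interval with endpoints in `ℕ ∪ {+∞}` (`hi = none` means `+∞`). -/
structure TimeItv where
  lo : ℕ
  hi : Option ℕ
  loIncl : Bool
  hiIncl : Bool
deriving DecidableEq

def TimeItv.Mem (I : TimeItv) (t : ℝ) : Prop :=
  (if I.loIncl then (I.lo : ℝ) ≤ t else (I.lo : ℝ) < t) ∧
  (match I.hi with
   | none => True
   | some h => if I.hiIncl then t ≤ (h : ℝ) else t < (h : ℝ))

def TimeItv.Nonsingular (I : TimeItv) : Prop :=
  match I.hi with
  | none => True
  | some h => I.lo < h

/-- The guard `x ∈ I` as a formula of `Γ(L)`. -/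
def TimeItv.memF {L : Type*} (I : TimeItv) : TransFormula L :=
  .and (if I.loIncl then .cmp .ge I.lo else .cmp .gt I.lo)
    (match I.hi with
     | none => .tt
     | some h => if I.hiIncl then .cmp .le h else .cmp .lt h)

/-- The guard `x ∉ I`. -/
def TimeItv.notMemF {L : Type*} (I : TimeItv) : TransFormula L :=
  .or (if I.loIncl then .cmp .lt I.lo else .cmp .le I.lo)
    (match I.hi with
     | none => .ff
     | some h => if I.hiIncl then .cmp .gt h else .cmp .ge h)

/-- The guard `x ≤ sup(I)`. -/
def TimeItv.leSupF {L : Type*} (I : TimeItv) : TransFormula L :=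
  match I.hi with
  | none => .tt
  | some h => .cmp .le h

/-- The guard `x > sup(I)`. -/
def TimeItv.gtSupF {L : Type*} (I : TimeItv) : TransFormula L :=
  match I.hi with
  | none => .ff
  | some h => .cmp .gt h

/-- `⌈inf(I)/|I|⌉` (0 when `I` is unbounded). -/
def TimeItv.ceilInfDiv (I : TimeItv) : ℕ :=
  match I.hi with
  | none => 0
  | some h => ⌈(I.lo : ℚ) / ((h : ℚ) - (I.lo : ℚ))⌉₊

/-- `⌈sup(I)/|I|⌉` (0 when `I` is unbounded). -/
def TimeItv.ceilSupDiv (I : TimeItv) : ℕ :=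
  match I.hi with
  | none => 0
  | some h => ⌈(h : ℚ) / ((h : ℚ) - (I.lo : ℚ))⌉₊

/-- MTL formulas; `untl` is `U_I` and `rele` is `Ũ_I`. -/
inductive MTL (A : Type*) : Type _
  | tt : MTL A
  | ff : MTL A
  | atom (a : A) : MTL A
  | neg (φ : MTL A) : MTL A
  | and (φ₁ φ₂ : MTL A) : MTL A
  | or (φ₁ φ₂ : MTL A) : MTL A
  | untl (φ₁ φ₂ : MTL A) (I : TimeItv) : MTL A
  | rele (φ₁ φ₂ : MTL A) (I : TimeItv) : MTL A

/-- The pointwise semantics `(θ, i) ⊨ φ` (`Ũ` by definition dual to `U`). -/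
def MTL.Sat {A : Type*} (θ : TimedWord A) : MTL A → ℕ → Prop
  | .tt, _ => True
  | .ff, _ => False
  | .atom a, i => θ.letter i = a
  | .neg φ, i => ¬ MTL.Sat θ φ i
  | .and φ₁ φ₂, i => MTL.Sat θ φ₁ i ∧ MTL.Sat θ φ₂ i
  | .or φ₁ φ₂, i => MTL.Sat θ φ₁ i ∨ MTL.Sat θ φ₂ i
  | .untl φ₁ φ₂ I, i => ∃ j, i ≤ j ∧ MTL.Sat θ φ₂ j ∧ I.Mem (θ.time j - θ.time i) ∧
      ∀ k, i ≤ k → k < j → MTL.Sat θ φ₁ k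
  | .rele φ₁ φ₂ I, i => ¬ ∃ j, i ≤ j ∧ ¬ MTL.Sat θ φ₂ j ∧ I.Mem (θ.time j - θ.time i) ∧
      ∀ k, i ≤ k → k < j → ¬ MTL.Sat θ φ₁ k

/-- `⟦φ⟧`. -/
def MTL.SemLang {A : Type*} (φ : MTL A) : Set (TimedWord A) := {θ | MTL.Sat θ φ 1}

/-- Negative normal form: negation only on letters. -/
def MTL.IsNNF {A : Type*} : MTL A → Prop
  | .neg (.atom _) => True
  | .neg _ => False
  | .and φ₁ φ₂ => φ₁.IsNNF ∧ φ₂.IsNNF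
  | .or φ₁ φ₂ => φ₁.IsNNF ∧ φ₂.IsNNF
  | .untl φ₁ φ₂ _ => φ₁.IsNNF ∧ φ₂.IsNNF
  | .rele φ₁ φ₂ _ => φ₁.IsNNF ∧ φ₂.IsNNF
  | _ => True

mutual
  /-- Negative normal form of a formula. -/
  def MTL.nnf {A : Type*} : MTL A → MTL A
    | .tt => .tt
    | .ff => .ff
    | .atom a => .atom a
    | .neg φ => MTL.nnfNeg φ
    | .and φ₁ φ₂ => .and (MTL.nnf φ₁) (MTL.nnf φ₂)
    | .or φ₁ φ₂ => .or (MTL.nnf φ₁) (MTL.nnf φ₂)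
    | .untl φ₁ φ₂ I => .untl (MTL.nnf φ₁) (MTL.nnf φ₂) I
    | .rele φ₁ φ₂ I => .rele (MTL.nnf φ₁) (MTL.nnf φ₂) I

  /-- Negative normal form of the negation of a formula. -/
  def MTL.nnfNeg {A : Type*} : MTL A → MTL A
    | .tt => .ff
    | .ff => .tt
    | .atom a => .neg (.atom a)
    | .neg φ => MTL.nnf φ
    | .and φ₁ φ₂ => .or (MTL.nnfNeg φ₁) (MTL.nnfNeg φ₂)
    | .or φ₁ φ₂ => .and (MTL.nnfNeg φ₁) (MTL.nnfNeg φ₂)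
    | .untl φ₁ φ₂ I => .rele (MTL.nnfNeg φ₁) (MTL.nnfNeg φ₂) I
    | .rele φ₁ φ₂ I => .untl (MTL.nnfNeg φ₁) (MTL.nnfNeg φ₂) I
end

/-- Outermost connective is `U` or `Ũ`. -/
def MTL.IsTemporal {A : Type*} : MTL A → Prop
  | .untl _ _ _ => True
  | .rele _ _ _ => True
  | _ => False

def MTL.IsRelease {A : Type*} : MTL A → Prop
  | .rele _ _ _ => True
  | _ => False

/-- Subformulas. -/
def MTL.Subf {A : Type*} : MTL A → Set (MTL A)
  | .tt => {MTL.tt}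
  | .ff => {MTL.ff}
  | .atom a => {MTL.atom a}
  | .neg φ => insert (MTL.neg φ) (MTL.Subf φ)
  | .and φ₁ φ₂ => insert (MTL.and φ₁ φ₂) (MTL.Subf φ₁ ∪ MTL.Subf φ₂)
  | .or φ₁ φ₂ => insert (MTL.or φ₁ φ₂) (MTL.Subf φ₁ ∪ MTL.Subf φ₂)
  | .untl φ₁ φ₂ I => insert (MTL.untl φ₁ φ₂ I) (MTL.Subf φ₁ ∪ MTL.Subf φ₂)
  | .rele φ₁ φ₂ I => insert (MTL.rele φ₁ φ₂ I) (MTL.Subf φ₁ ∪ MTL.Subf φ₂)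

/-- MITL wellformedness: every interval is non-singular. -/
def MTL.MITLwf {A : Type*} : MTL A → Prop
  | .neg φ => MTL.MITLwf φ
  | .and φ₁ φ₂ => φ₁.MITLwf ∧ φ₂.MITLwf
  | .or φ₁ φ₂ => φ₁.MITLwf ∧ φ₂.MITLwf
  | .untl φ₁ φ₂ I => I.Nonsingular ∧ φ₁.MITLwf ∧ φ₂.MITLwf
  | .rele φ₁ φ₂ I => I.Nonsingular ∧ φ₁.MITLwf ∧ φ₂.MITLwf
  | _ => True

/-! ### The Ouaknine–Worrell construction `A_φ` -/

/-- `δ(φ,σ)`, with locations named by raw formulas. -/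
def MTL.trans {A : Type*} [DecidableEq A] : MTL A → A → TransFormula (MTL A)
  | .tt, _ => .tt
  | .ff, _ => .ff
  | .atom a, σ => if a = σ then .tt else .ff
  | .neg (.atom a), σ => if a = σ then .ff else .tt
  | .neg _, _ => .ff
  | .and φ₁ φ₂, σ => .and (MTL.trans φ₁ σ) (MTL.trans φ₂ σ)
  | .or φ₁ φ₂, σ => .or (MTL.trans φ₁ σ) (MTL.trans φ₂ σ)
  | .untl φ₁ φ₂ I, σ =>
      .or (.and (.reset (MTL.trans φ₂ σ)) I.memF)
          (.and (.reset (MTL.trans φ₁ σ)) (.and (.loc (.untl φ₁ φ₂ I)) I.leSupF))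
  | .rele φ₁ φ₂ I, σ =>
      .and (.or (.reset (MTL.trans φ₂ σ)) I.notMemF)
           (.or (.reset (MTL.trans φ₁ σ)) (.or (.loc (.rele φ₁ φ₂ I)) I.gtSupF))

/-- Locations of `A_φ`: `φ_init` (i.e. `none`) together with the `U`/`Ũ`-subformulas of `φ`. -/
def MTLLoc {A : Type*} (φ : MTL A) : Type _ :=
  Option {ψ : MTL A // ψ ∈ MTL.Subf φ ∧ MTL.IsTemporal ψ}

open Classical in
noncomputable def embedLoc {A : Type*} (φ : MTL A) (ψ : MTL A) : MTLLoc φ :=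
  if h : ψ ∈ MTL.Subf φ ∧ MTL.IsTemporal ψ then some ⟨ψ, h⟩ else none

/-- The OCATA `A_φ`. -/
noncomputable def mtlOCATA {A : Type*} [DecidableEq A] (φ : MTL A) : OCATA A (MTLLoc φ) where
  init := none
  final := {l | ∃ p, l = some p ∧ MTL.IsRelease p.1}
  δ := fun l σ =>
    match l with
    | none => .reset ((MTL.trans φ σ).map (embedLoc φ))
    | some p => (MTL.trans p.1 σ).map (embedLoc φ)

/-! ### The bound `M(φ)` -/

/-- `(M(φ), M^∞(φ), M^1(φ))`. -/
def MTL.Mtriple {A : Type*} : MTL A → ℕ × ℕ × ℕ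
  | .and φ₁ φ₂ =>
      let t₁ := MTL.Mtriple φ₁; let t₂ := MTL.Mtriple φ₂
      (max 2 (t₁.2.2 + t₂.2.2), t₁.2.1 + t₂.2.1, t₁.2.2 + t₂.2.2)
  | .or φ₁ φ₂ =>
      let t₁ := MTL.Mtriple φ₁; let t₂ := MTL.Mtriple φ₂
      (max 2 (max t₁.2.2 t₂.2.2), max t₁.2.1 t₂.2.1, max t₁.2.2 t₂.2.2)
  | .untl φ₁ φ₂ I =>
      let t₁ := MTL.Mtriple φ₁; let t₂ := MTL.Mtriple φ₂
      (max 2 (t₁.2.1 + t₂.2.2 + 1), (4 * I.ceilInfDiv + 2) + t₁.2.1 + t₂.2.1,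
        t₁.2.1 + t₂.2.2 + 1)
  | .rele φ₁ φ₂ I =>
      let t₁ := MTL.Mtriple φ₁; let t₂ := MTL.Mtriple φ₂
      (max 2 (t₁.2.2 + t₂.2.1 + 1), (2 * I.ceilSupDiv + 2) + t₁.2.1 + t₂.2.1,
        t₁.2.2 + t₂.2.1 + 1)
  | _ => (2, 0, 0)

/-- `M(φ)`. -/
def MTL.M {A : Type*} (φ : MTL A) : ℕ := φ.Mtriple.1

/-! ### The `Merge` operation and the approximation functions `F^k` -/

/-- `I < J` for intervals. -/
def ItvLT (I J : Set ℝ) : Prop := ∀ x ∈ I, ∀ y ∈ J, x < y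

/-- `E'` is obtained from `E` by merging the smallest interval `[0,0]` with
the next interval `I₁` into `[0, sup I₁]`. -/
def MergedOf (E E' : Set (Set ℝ)) : Prop :=
  zeroItv ∈ E ∧ ∃ I₁ ∈ E, I₁ ≠ zeroItv ∧
    (∀ J ∈ E, J ≠ zeroItv → J ≠ I₁ → ItvLT I₁ J) ∧
    E' = insert (Set.Icc 0 (sSup I₁)) (E \ {zeroItv, I₁})

/-- `E' ∈ {Merge(E), E}`. -/
def MergeChoice (E E' : Set (Set ℝ)) : Prop := E' = E ∨ MergedOf E E'

/-- `Merge(C,k)`. -/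
def MergeCk {L : Type*} (C : Set (OState L)) (k : ℕ) : Set (Set (OState L)) :=
  {C' | nbClocksC C' ≤ k ∧ ∀ ℓ, MergeChoice (locSet C ℓ) (locSet C' ℓ)}

/-- Grouping all the intervals of each location into a single interval. -/
def squash {L : Type*} (C : Set (OState L)) : Set (OState L) :=
  {s | (locSet C s.1).Nonempty ∧
    s.2 = Set.Icc (sInf (⋃ I ∈ locSet C s.1, I)) (sSup (⋃ I ∈ locSet C s.1, I))}

open Classical in
/-- The approximation function `F^k`. -/
noncomputable def Fk {L : Type*} (k : ℕ) (C : Set (OState L)) : Set (Set (OState L)) :=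
  if (MergeCk C k).Nonempty then MergeCk C k else {squash C}

/-! ### The Miyano–Hayashi construction -/

/-- Marked configurations. -/
abbrev MState (L : Type*) := Set (L × Set ℝ × Bool)

/-- The underlying configuration. -/
def MState.conf {L : Type*} (s : MState L) : Set (OState L) := (fun x => (x.1, x.2.1)) '' s

/-- All markers are `⊤`. -/
def MState.allTrue {L : Type*} (s : MState L) : Prop := ∀ x ∈ s, x.2.2 = true

def shiftM {L : Type*} (s : MState L) (t : ℝ) : MState L :=
  (fun x => (x.1, shiftItv x.2.1 t, x.2.2)) '' s

/-- Reset all markers to `⊥`. -/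
def resetMarksM {L : Type*} (s : MState L) : MState L := (fun x => (x.1, x.2.1, false)) '' s

/-- A discrete Miyano–Hayashi step (from a non-accepting marked state). -/
def MHStepCore {A L : Type*} (Aut : OCATA A L) (f : Set (OState L) → Set (Set (OState L)))
    (σ : A) (s s' : MState L) : Prop :=
  ∃ m : OState L → Set (OState L),
    (∀ q ∈ MState.conf s, IsMinModel (m q) (Aut.δ q.1 σ) q.2) ∧
    MState.conf s' ∈ f (⋃ q ∈ MState.conf s, m q) ∧
    (∀ ℓ I b₁ b₂, (ℓ, I, b₁) ∈ s' → (ℓ, I, b₂) ∈ s' → b₁ = b₂) ∧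
    (∀ x ∈ s', x.1 ∈ Aut.final → x.2.2 = true) ∧
    (∀ x ∈ s', x.1 ∉ Aut.final →
      (x.2.2 = false ↔ ∃ ℓ I, (ℓ, I, false) ∈ s ∧ ∃ I', (x.1, I') ∈ m (ℓ, I) ∧ I' ⊆ x.2.1))

/-- A discrete step of `MH(A,f)` (markers of an accepting state are first reset to `⊥`). -/
def MHStep {A L : Type*} (Aut : OCATA A L) (f : Set (OState L) → Set (Set (OState L)))
    (σ : A) (s s' : MState L) : Prop :=
  (MState.allTrue s ∧ MHStepCore Aut f σ (resetMarksM s) s') ∨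
  (¬ MState.allTrue s ∧ MHStepCore Aut f σ s s')

structure MHRun {A L : Type*} (Aut : OCATA A L)
    (f : Set (OState L) → Set (Set (OState L))) (θ : TimedWord A) where
  st : ℕ → MState L
  init : st 0 = {(Aut.init, zeroItv, false)}
  step : ∀ i, MHStep Aut f (θ.letter (i + 1)) (shiftM (st i) (θ.time (i + 1) - θ.time i))
    (st (i + 1))

/-- Büchi acceptance on `α` (all markers `⊤`). -/
def MHRun.Accepting {A L : Type*} {Aut : OCATA A L}
    {f : Set (OState L) → Set (Set (OState L))} {θ : TimedWord A}
    (ρ : MHRun Aut f θ) : Prop :=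
  ∀ N, ∃ i, N ≤ i ∧ MState.allTrue (ρ.st i)

/-- `L^ω(MH(A,f))`. -/
def MHLang {A L : Type*} (Aut : OCATA A L)
    (f : Set (OState L) → Set (Set (OState L))) : Set (TimedWord A) :=
  {θ | ∃ ρ : MHRun Aut f θ, ρ.Accepting}

/-! ### Büchi timed automata -/

/-- A Büchi timed automaton with locations `Q` and clocks `X`; a transition
`(b, σ, g, r, b')` has guard `g` (a finite conjunction of clock constraints) and reset `r`. -/
structure TBA (A : Type*) (Q : Type*) (X : Type*) where
  init : Q
  final : Set Q
  trans : Set (Q × A × List (X × Cmp × ℕ) × Set X × Q)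

def GuardSat {X : Type*} (g : List (X × Cmp × ℕ)) (v : X → ℝ) : Prop :=
  ∀ c ∈ g, Cmp.eval c.2.1 (v c.1) c.2.2

open Classical in
noncomputable def resetVal {X : Type*} (r : Set X) (v : X → ℝ) : X → ℝ :=
  fun x => if x ∈ r then 0 else v x

structure TBARun {A Q X : Type*} (B : TBA A Q X) (θ : TimedWord A) where
  loc : ℕ → Q
  val : ℕ → X → ℝ
  init_loc : loc 0 = B.init
  init_val : val 0 = fun _ => 0
  step : ∀ i, ∃ g r, (loc i, θ.letter (i + 1), g, r, loc (i + 1)) ∈ B.trans ∧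
    GuardSat g (fun x => val i x + (θ.time (i + 1) - θ.time i)) ∧
    val (i + 1) = resetVal r (fun x => val i x + (θ.time (i + 1) - θ.time i))

def TBARun.Accepting {A Q X : Type*} {B : TBA A Q X} {θ : TimedWord A}
    (ρ : TBARun B θ) : Prop :=
  ∀ N, ∃ i, N ≤ i ∧ ρ.loc i ∈ B.final

/-- `L^ω(B)`. -/
def TBALang {A Q X : Type*} (B : TBA A Q X) : Set (TimedWord A) :=
  {θ | ∃ ρ : TBARun B θ, ρ.Accepting}


universe u

/-! ### Ranks on least fixed points and determinacy -/

/-- The elements of a least fixed point are ranked by the stage at which they appear in the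
transfinite iteration. -/
theorem exists_rank_lfp {P : Type u} (f : Set P →o Set P) :
    ∃ r : P → Ordinal.{u}, ∀ p ∈ f.lfp, ∃ Z : Set P, p ∈ f Z ∧
      Z ⊆ {q | q ∈ f.lfp ∧ r q < r p} ∧ f Z ⊆ {q | q ∈ f.lfp ∧ r q ≤ r p} := by
  set stage := OrdinalApprox.lfpApprox f ⊥ with hstage
  have hsub : ∀ a, stage a ⊆ f.lfp := fun a =>
    OrdinalApprox.lfpApprox_le_of_mem_fixedPoints f f.map_lfp bot_le a
  have hle : ∀ a, ∀ q ∈ stage a, sInf {b | q ∈ stage b} ≤ a := fun a q hq => csInf_le' hq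
  refine ⟨fun p => sInf {a | p ∈ stage a}, fun p hp => ?_⟩
  have hne : {a | p ∈ stage a}.Nonempty := by
    obtain ⟨a, ha⟩ := OrdinalApprox.lfp_mem_range_lfpApprox f
    exact ⟨a, by rw [Set.mem_ofPred_eq, hstage, ha]; exact hp⟩
  have hmem : p ∈ stage (sInf {a | p ∈ stage a}) := csInf_mem hne
  have hmem' := hmem
  rw [hstage, OrdinalApprox.lfpApprox] at hmem'
  simp only [Set.sup_eq_union, Set.bot_eq_empty, Set.empty_union, Set.iSup_eq_iUnion,
    Set.mem_iUnion, exists_prop] at hmem'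
  obtain ⟨b, hb, hpb⟩ := hmem'
  refine ⟨stage b, hpb, fun q hq => ⟨hsub b hq, (hle b q hq).trans_lt hb⟩, fun q hq => ?_⟩
  have hq' := OrdinalApprox.apply_lfpApprox_le_lfpApprox_of_lt f hb hq
  exact ⟨hsub _ hq', hle _ q hq'⟩

/-- Ranked determinacy of Büchi games: outside `D` one player can visit `F` infinitely often,
inside `D` the opponent can visit `F` only finitely often. -/
theorem exists_determined_region {P : Type u} (F : Set P) (pre : Set P →o Set P) :
    ∃ (D : Set P) (r r' : P → Ordinal.{u}),
      (∀ p ∉ D, p ∈ F → p ∈ pre Dᶜ) ∧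
      (∀ p ∉ D, p ∉ F → p ∈ pre {q | q ∉ D ∧ r q < r p}) ∧
      (∀ p ∈ D, p ∈ F → p ∉ pre {q | q ∈ D ∧ r' q < r' p}ᶜ) ∧
      (∀ p ∈ D, p ∉ F → p ∉ pre {q | q ∈ D ∧ r' q ≤ r' p}ᶜ) := by
  let Φ : Set P → Set P →o Set P := fun X =>
    { toFun := fun Y => {p | (p ∈ F → p ∉ pre Xᶜ) ∧ (p ∉ F → p ∉ pre Yᶜ)}
      monotone' := fun Y Y' h p hp => ⟨hp.1, fun hF hc =>
        hp.2 hF (pre.monotone (Set.compl_subset_compl.2 h) hc)⟩ }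
  let f : Set P →o Set P :=
    { toFun := fun X => (Φ X).gfp
      monotone' := fun X X' h => OrderHom.gfp.monotone fun Y p hp => ⟨fun hF hc =>
        hp.1 hF (pre.monotone (Set.compl_subset_compl.2 h) hc), hp.2⟩ }
  let g : Set P →o Set P :=
    { toFun := fun Y => (Φ f.lfp Yᶜ)ᶜ
      monotone' := fun Y Y' h => Set.compl_subset_compl.2
        ((Φ f.lfp).monotone (Set.compl_subset_compl.2 h)) }
  have hD : (Φ f.lfp).gfp = f.lfp := f.map_lfp
  have hfix : Φ f.lfp f.lfp = f.lfp := by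
    have h := (Φ f.lfp).map_gfp
    rwa [hD] at h
  have hg : g.lfp = f.lfpᶜ := by
    apply le_antisymm
    · apply g.lfp_le
      change (Φ f.lfp f.lfpᶜᶜ)ᶜ ⊆ f.lfpᶜ
      rw [compl_compl, hfix]
    · have h : Φ f.lfp g.lfpᶜ = g.lfpᶜ := compl_eq_comm.1 g.map_lfp |>.symm
      have hle : g.lfpᶜ ≤ (Φ f.lfp).gfp := (Φ f.lfp).le_gfp h.ge
      rw [hD] at hle
      exact Set.compl_subset_comm.1 hle
  obtain ⟨r, hr⟩ := exists_rank_lfp g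
  obtain ⟨r', hr'⟩ := exists_rank_lfp f
  rw [hg] at hr
  refine ⟨f.lfp, r, r', fun p hp hF => ?_, fun p hp hF => ?_, fun p hp hF => ?_,
    fun p hp hF => ?_⟩
  · obtain ⟨Z, hZ, -, -⟩ := hr p hp
    by_contra hc
    exact hZ ⟨fun _ => hc, fun h => absurd hF h⟩
  · obtain ⟨Z, hZ, hlt, -⟩ := hr p hp
    by_contra hc
    refine hZ ⟨fun h => absurd h hF, fun _ h => hc ?_⟩
    rw [compl_compl] at h
    exact pre.monotone hlt h
  · obtain ⟨Z, hZ, hlt, -⟩ := hr' p hp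
    change p ∈ (Φ Z).gfp at hZ
    rw [← (Φ Z).map_gfp] at hZ
    exact fun h => hZ.1 hF (pre.monotone (Set.compl_subset_compl.2 hlt) h)
  · obtain ⟨Z, hZ, -, hle⟩ := hr' p hp
    change p ∈ (Φ Z).gfp at hZ
    rw [← (Φ Z).map_gfp] at hZ
    exact fun h => hZ.2 hF (pre.monotone (Set.compl_subset_compl.2 hle) h)

/-! ### Models of transition formulas -/

theorem Models.mono {L : Type*} {M M' : Set (OState L)} (h : M ⊆ M') :
    ∀ {γ : TransFormula L} {I : Set ℝ}, Models M γ I → Models M' γ I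
  | .tt, _, _ => trivial
  | .or _ _, _, hm => hm.imp (Models.mono h) (Models.mono h)
  | .and _ _, _, hm => ⟨Models.mono h hm.1, Models.mono h hm.2⟩
  | .loc _, _, hm => h hm
  | .cmp _ _, _, hm => hm
  | .reset γ, _, hm => Models.mono (γ := γ) h hm

theorem Cmp.eval_negate (op : Cmp) (v : ℝ) (c : ℕ) : op.negate.eval v c ↔ ¬ op.eval v c := by
  cases op <;> simp [Cmp.eval, Cmp.negate]

/-- On singular intervals, the dual formula is the De Morgan dual. -/
theorem models_dual_iff {L : Type*} (M : Set (OState L)) (γ : TransFormula L) (v : ℝ) :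
    Models M γ.dual {v} ↔ ¬ Models Mᶜ γ {v} := by
  induction γ generalizing v with
  | tt => simp [TransFormula.dual, Models]
  | ff => simp [TransFormula.dual, Models]
  | or γ₁ γ₂ h₁ h₂ => simp [TransFormula.dual, Models, h₁, h₂]
  | and γ₁ γ₂ h₁ h₂ => simp only [TransFormula.dual, Models, h₁, h₂]; tauto
  | loc ℓ => simp [TransFormula.dual, Models]
  | cmp op c => simp [TransFormula.dual, Models, Cmp.eval_negate]
  | reset γ h => exact h 0

/-- The states on which the satisfaction of `γ` w.r.t. `I` depends. -/
def relevantStates {L : Type*} (γ : TransFormula L) (I : Set ℝ) : Set (OState L) :=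
  {s | s.1 ∈ γ.locs ∧ (s.2 = I ∨ s.2 = zeroItv)}

theorem models_inter_of_relevantStates_subset {L : Type*} {M T : Set (OState L)}
    {γ : TransFormula L} {I : Set ℝ} (hT : relevantStates γ I ⊆ T) (h : Models M γ I) :
    Models (M ∩ T) γ I := by
  induction γ generalizing I with
  | tt => trivial
  | ff => exact h
  | or γ₁ γ₂ h₁ h₂ =>
    exact h.imp (h₁ fun s hs => hT ⟨Or.inl hs.1, hs.2⟩) (h₂ fun s hs => hT ⟨Or.inr hs.1, hs.2⟩)
  | and γ₁ γ₂ h₁ h₂ =>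
    exact ⟨h₁ (fun s hs => hT ⟨Or.inl hs.1, hs.2⟩) h.1,
      h₂ (fun s hs => hT ⟨Or.inr hs.1, hs.2⟩) h.2⟩
  | loc ℓ => exact ⟨h, hT ⟨rfl, Or.inl rfl⟩⟩
  | cmp op c => exact h
  | reset γ ih => exact ih (I := zeroItv) (fun s hs => hT ⟨hs.1, Or.inr (hs.2.elim id id)⟩) h

theorem IsMinModel.subset_relevantStates {L : Type*} {M : Set (OState L)} {γ : TransFormula L}
    {I : Set ℝ} (h : IsMinModel M γ I) : M ⊆ relevantStates γ I := by
  by_contra hc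
  exact h.2 _ ⟨Set.inter_subset_left, fun h' => hc fun s hs => (h' hs).2⟩
    (models_inter_of_relevantStates_subset subset_rfl h.1)

theorem finite_relevantStates {L : Type*} [Finite L] (γ : TransFormula L) (I : Set ℝ) :
    (relevantStates γ I).Finite :=
  ((Set.toFinite (Set.univ : Set L)).prod (Set.toFinite {I, zeroItv})).subset
    fun _ hs => ⟨trivial, hs.2⟩

theorem Models.exists_isMinModel {L : Type*} [Finite L] {M : Set (OState L)}
    {γ : TransFormula L} {I : Set ℝ} (h : Models M γ I) : ∃ M' ⊆ M, IsMinModel M' γ I := by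
  have hfin : {N | N ⊆ M ∩ relevantStates γ I ∧ Models N γ I}.Finite :=
    ((finite_relevantStates γ I).finite_subsets).subset fun N hN =>
      hN.1.trans Set.inter_subset_right
  obtain ⟨M', -, hM'⟩ := hfin.exists_le_minimal
    ⟨subset_rfl, models_inter_of_relevantStates_subset subset_rfl h⟩
  exact ⟨M', hM'.prop.1.trans Set.inter_subset_left, hM'.prop.2, fun N hN hm =>
    hN.2 (hM'.le_of_le ⟨hN.1.trans hM'.prop.1, hm⟩ hN.1)⟩

/-! ### Runs from positional strategies -/

/-- The state `s` after the delay between the positions `i` and `i + 1` of `θ`. -/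
def TimedWord.delay {A L : Type*} (θ : TimedWord A) (i : ℕ) (s : OState L) : OState L :=
  (s.1, shiftItv s.2 (θ.time (i + 1) - θ.time i))

theorem TimedWord.delay_of_singleton {A L : Type*} (θ : TimedWord A) (i : ℕ) {s : OState L}
    {v : ℝ} (h : s.2 = {v}) : (θ.delay i s).2 = {v + (θ.time (i + 1) - θ.time i)} := by
  simp [TimedWord.delay, shiftItv, h]

theorem TimedWord.sub_nonneg {A : Type*} (θ : TimedWord A) (i : ℕ) :
    0 ≤ θ.time (i + 1) - θ.time i :=
  _root_.sub_nonneg.2 (θ.mono i.le_succ)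

/-- The delayed states at position `i` from which the player choosing models can move into `X`. -/
def controlledPre {A L : Type*} (Aut : OCATA A L) (θ : TimedWord A) :
    Set (ℕ × OState L) →o Set (ℕ × OState L) where
  toFun X := {p | Models {s | (p.1 + 1, θ.delay (p.1 + 1) s) ∈ X}
    (Aut.δ p.2.1 (θ.letter (p.1 + 1))) p.2.2}
  monotone' _ _ h _ hp := Models.mono (fun _ hs => h hs) hp

theorem mem_controlledPre_dual_iff {A L : Type*} (Aut : OCATA A L) (θ : TimedWord A)
    (X : Set (ℕ × OState L)) (i : ℕ) (s : OState L) {v : ℝ} (hs : s.2 = {v}) :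
    (i, s) ∈ controlledPre Aut.dual θ X ↔ (i, s) ∉ controlledPre Aut θ Xᶜ := by
  change Models _ (Aut.δ s.1 _).dual s.2 ↔ ¬ Models _ (Aut.δ s.1 _) s.2
  rw [hs, models_dual_iff]
  rfl

theorem FRun.singleton_of_mem_config {A L : Type*} {Aut : OCATA A L} {θ : TimedWord A}
    (ρ : FRun Aut IdApprox θ) (i : ℕ) : ∀ s ∈ ρ.config i, ∃ v, s.2 = {v} := by
  induction i with
  | zero =>
    intro s hs
    rw [ρ.init] at hs
    exact ⟨0, by rw [Set.mem_singleton_iff.1 hs]; rfl⟩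
  | succ i ih =>
    intro s hs
    have hsucc : ρ.config (i + 1) = _ := ρ.succ i
    rw [hsucc] at hs
    simp only [Set.mem_iUnion, exists_prop] at hs
    obtain ⟨_, ⟨q, hq, rfl⟩, hs⟩ := hs
    obtain ⟨v, hv⟩ := ih q hq
    rcases ((ρ.minModel i _ ⟨q, hq, rfl⟩).subset_relevantStates hs).2 with h | h
    · exact ⟨_, h.trans (θ.delay_of_singleton i hv)⟩
    · exact ⟨0, h⟩

/-- A positional strategy `S` on a region `W` containing the initial state induces a run whose
branches are plays according to `S`. -/
theorem exists_run_of_strategy {A L : Type*} [Finite L] (Aut : OCATA A L) (θ : TimedWord A)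
    (W : Set (ℕ × OState L)) (S : ℕ × OState L → Set (ℕ × OState L))
    (hinit : (0, θ.delay 0 (Aut.init, zeroItv)) ∈ W) (hSW : ∀ p ∈ W, S p ⊆ W)
    (hS : ∀ i s v, s.2 = {v} → (i, s) ∈ W → (i, s) ∈ controlledPre Aut θ (S (i, s))) :
    ∃ ρ : FRun Aut IdApprox θ, ∀ β, ρ.IsBranch β → ∀ i,
      (i, θ.delay i (β i)) ∈ W ∧ (i + 1, θ.delay (i + 1) (β (i + 1))) ∈ S (i, θ.delay i (β i)) := by
  have hmodel : ∀ i s, ∃ M : Set (OState L), (∃ v, s.2 = {v}) → (i, s) ∈ W →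
      IsMinModel M (Aut.δ s.1 (θ.letter (i + 1))) s.2 ∧
        ∀ s' ∈ M, (i + 1, θ.delay (i + 1) s') ∈ S (i, s) := by
    intro i s
    by_cases h : (∃ v, s.2 = {v}) ∧ (i, s) ∈ W
    · obtain ⟨⟨v, hv⟩, hW⟩ := h
      obtain ⟨M, hsub, hM⟩ := Models.exists_isMinModel (hS i s v hv hW)
      exact ⟨M, fun _ _ => ⟨hM, fun s' hs' => hsub hs'⟩⟩
    · exact ⟨∅, fun h₁ h₂ => absurd ⟨h₁, h₂⟩ h⟩
  choose m hm using hmodel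
  let C : ℕ → Set (OState L) := fun n => Nat.rec {(Aut.init, zeroItv)}
    (fun i c => ⋃ s ∈ shiftCfg c (θ.time (i + 1) - θ.time i), m i s) n
  have hinv : ∀ i, (C i).Finite ∧
      ∀ s ∈ C i, (∃ v, 0 ≤ v ∧ s.2 = {v}) ∧ (i, θ.delay i s) ∈ W := by
    intro i
    induction i with
    | zero =>
      refine ⟨Set.finite_singleton _, fun s hs => ?_⟩
      obtain rfl : s = (Aut.init, zeroItv) := hs
      exact ⟨⟨0, le_rfl, rfl⟩, hinit⟩
    | succ i ih =>
      have hmin : ∀ q ∈ C i, IsMinModel (m i (θ.delay i q))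
          (Aut.δ q.1 (θ.letter (i + 1))) (θ.delay i q).2 ∧
            ∀ s' ∈ m i (θ.delay i q), (i + 1, θ.delay (i + 1) s') ∈ S (i, θ.delay i q) := by
        intro q hq
        obtain ⟨⟨v, -, hv⟩, hW⟩ := ih.2 q hq
        exact hm i (θ.delay i q) ⟨_, θ.delay_of_singleton i hv⟩ hW
      constructor
      · refine (ih.1.image _).biUnion ?_
        rintro _ ⟨q, hq, rfl⟩
        exact (finite_relevantStates _ _).subset (hmin q hq).1.subset_relevantStates
      · intro s hs
        change s ∈ ⋃ s ∈ shiftCfg (C i) (θ.time (i + 1) - θ.time i), m i s at hs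
        simp only [Set.mem_iUnion, exists_prop] at hs
        obtain ⟨_, ⟨q, hq, rfl⟩, hs⟩ := hs
        obtain ⟨⟨v, hv0, hv⟩, hW⟩ := ih.2 q hq
        refine ⟨?_, hSW _ hW ((hmin q hq).2 s hs)⟩
        rcases ((hmin q hq).1.subset_relevantStates hs).2 with h | h
        · exact ⟨_, add_nonneg hv0 (θ.sub_nonneg i), h.trans (θ.delay_of_singleton i hv)⟩
        · exact ⟨0, le_rfl, h⟩
  let ρ : FRun Aut IdApprox θ :=
    { config := C
      model := m
      init := rfl
      isConfig := by
        refine fun i => ⟨(hinv i).1, fun s hs => ?_, fun ℓ I J hI hJ hIJ => ?_⟩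
        · obtain ⟨v, hv0, hv⟩ := ((hinv i).2 s hs).1
          rw [hv]
          exact ⟨Set.singleton_nonempty v, Set.ordConnected_singleton, bddAbove_singleton,
            fun x hx => hx ▸ hv0⟩
        · obtain ⟨v, -, rfl : I = {v}⟩ := ((hinv i).2 _ hI).1
          obtain ⟨w, -, rfl : J = {w}⟩ := ((hinv i).2 _ hJ).1
          exact Set.disjoint_singleton.2 fun h => hIJ (h ▸ rfl)
      minModel := by
        rintro i _ ⟨q, hq, rfl⟩
        obtain ⟨⟨v, -, hv⟩, hW⟩ := (hinv i).2 q hq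
        exact (hm i (θ.delay i q) ⟨_, θ.delay_of_singleton i hv⟩ hW).1
      succ := fun i => rfl }
  refine ⟨ρ, fun β hβ i => ?_⟩
  obtain ⟨hq, hq', I, hI, hsub⟩ := hβ.2 i
  obtain ⟨⟨v, -, hv⟩, hW⟩ := (hinv i).2 _ hq
  obtain ⟨⟨w, -, hw⟩, -⟩ := (hinv (i + 1)).2 _ hq'
  refine ⟨hW, ?_⟩
  obtain ⟨hmin, hmS⟩ := hm i (θ.delay i (β i)) ⟨_, θ.delay_of_singleton i hv⟩ hW
  have hIw : I = (β (i + 1)).2 := by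
    have hne : I.Nonempty := by
      rcases (hmin.subset_relevantStates hI).2 with h | h
      · rw [show I = _ from h, θ.delay_of_singleton i hv]
        exact Set.singleton_nonempty _
      · rw [show I = _ from h]
        exact Set.singleton_nonempty _
    rw [hw] at hsub ⊢
    exact hne.subset_singleton_iff.1 hsub
  rw [hIw] at hI
  exact hmS _ hI

/-- Every timed word is accepted by the automaton or by its dual. -/
theorem mem_FLang_or_mem_FLang_dual {A L : Type*} [Finite L] (Aut : OCATA A L)
    (θ : TimedWord A) : θ ∈ FLang Aut IdApprox ∨ θ ∈ FLang Aut.dual IdApprox := by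
  obtain ⟨D, r, r', h₁, h₂, h₃, h₄⟩ :=
    exists_determined_region {p : ℕ × OState L | p.2.1 ∈ Aut.final} (controlledPre Aut θ)
  by_cases hD : (0, θ.delay 0 (Aut.init, zeroItv)) ∈ D
  · right
    obtain ⟨ρ, hρ⟩ := exists_run_of_strategy Aut.dual θ D
      (fun p => {q | q ∈ D ∧ r' q ≤ r' p ∧ (p.2.1 ∈ Aut.final → r' q < r' p)}) hD
      (fun p _ q hq => hq.1) (by
        intro i s v hv hs
        rw [mem_controlledPre_dual_iff Aut θ _ i s hv]
        by_cases hF : s.1 ∈ Aut.final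
        · refine fun hc => h₃ _ hs hF ((controlledPre Aut θ).monotone ?_ hc)
          exact Set.compl_subset_compl.2 fun q hq => ⟨hq.1, hq.2.le, fun _ => hq.2⟩
        · refine fun hc => h₄ _ hs hF ((controlledPre Aut θ).monotone ?_ hc)
          exact Set.compl_subset_compl.2 fun q hq => ⟨hq.1, hq.2, fun h => absurd h hF⟩)
    refine ⟨ρ, fun β hβ N => ?_⟩
    by_contra! hc
    obtain ⟨n, hn⟩ := WellFounded.not_rel_apply_succ (r := (· < ·))
      fun n => r' (N + n, θ.delay (N + n) (β (N + n)))
    refine hn ((hρ β hβ (N + n)).2.2.2 ?_)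
    exact not_not.1 (hc (N + n) (Nat.le_add_right _ _))
  · left
    obtain ⟨ρ, hρ⟩ := exists_run_of_strategy Aut θ Dᶜ
      (fun p => {q | q ∉ D ∧ (p.2.1 ∉ Aut.final → r q < r p)}) hD
      (fun p _ q hq => hq.1) (by
        intro i s v _ hs
        by_cases hF : s.1 ∈ Aut.final
        · refine (controlledPre Aut θ).monotone ?_ (h₁ _ hs hF)
          exact fun q hq => ⟨hq, fun h => absurd hF h⟩
        · refine (controlledPre Aut θ).monotone ?_ (h₂ _ hs hF)
          exact fun q hq => ⟨hq.1, fun _ => hq.2⟩)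
    refine ⟨ρ, fun β hβ N => ?_⟩
    by_contra! hc
    obtain ⟨n, hn⟩ := WellFounded.not_rel_apply_succ (r := (· < ·))
      fun n => r (N + n, θ.delay (N + n) (β (N + n)))
    exact hn ((hρ β hβ (N + n)).2.2 (hc (N + n) (Nat.le_add_right _ _)))

/-! ### Disjointness -/

/-- A run of an automaton and a run of its dual on the same timed word share a branch. -/
theorem exists_common_branch {A L : Type*} {Aut : OCATA A L} {θ : TimedWord A}
    (ρ : FRun Aut IdApprox θ) (ρ' : FRun Aut.dual IdApprox θ) :
    ∃ β, ρ.IsBranch β ∧ ρ'.IsBranch β ∧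
      ∀ i, (β (i + 1)).1 ∈ (Aut.δ (β i).1 (θ.letter (i + 1))).locs := by
  have hstep : ∀ i (s : OState L), ∃ s' : OState L, s ∈ ρ.config i → s ∈ ρ'.config i →
      s' ∈ ρ.model i (θ.delay i s) ∧ s' ∈ ρ'.model i (θ.delay i s) := by
    intro i s
    by_cases h : s ∈ ρ.config i ∧ s ∈ ρ'.config i
    · obtain ⟨v, hv⟩ := ρ.singleton_of_mem_config i s h.1
      have hm := (ρ.minModel i (θ.delay i s) ⟨s, h.1, rfl⟩).1
      have hm' := (ρ'.minModel i (θ.delay i s) ⟨s, h.2, rfl⟩).1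
      rw [θ.delay_of_singleton i hv] at hm hm'
      change Models _ (Aut.δ s.1 _).dual _ at hm'
      rw [models_dual_iff] at hm'
      by_contra! hc
      exact hm' (hm.mono fun s' hs' => (hc s').2.2 hs')
    · exact ⟨s, fun h₁ h₂ => absurd ⟨h₁, h₂⟩ h⟩
  choose nxt hnxt using hstep
  let β : ℕ → OState L := fun n => Nat.rec (Aut.init, zeroItv) nxt n
  have hmem : ∀ i, β i ∈ ρ.config i ∧ β i ∈ ρ'.config i := by
    intro i
    induction i with
    | zero =>
      rw [ρ.init, ρ'.init]
      exact ⟨rfl, rfl⟩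
    | succ i ih =>
      have hsucc : ρ.config (i + 1) = _ := ρ.succ i
      have hsucc' : ρ'.config (i + 1) = _ := ρ'.succ i
      obtain ⟨h, h'⟩ := hnxt i (β i) ih.1 ih.2
      rw [hsucc, hsucc']
      exact ⟨Set.mem_biUnion ⟨β i, ih.1, rfl⟩ h, Set.mem_biUnion ⟨β i, ih.2, rfl⟩ h'⟩
  have hmod := fun i => hnxt i (β i) (hmem i).1 (hmem i).2
  exact ⟨β,
    ⟨rfl, fun i => ⟨(hmem i).1, (hmem (i + 1)).1, _, (hmod i).1, subset_rfl⟩⟩,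
    ⟨rfl, fun i => ⟨(hmem i).2, (hmem (i + 1)).2, _, (hmod i).2, subset_rfl⟩⟩,
    fun i => ((ρ.minModel i _ ⟨β i, (hmem i).1, rfl⟩).subset_relevantStates (hmod i).1).1⟩

theorem exists_frequently_eq {L : Type*} [Finite L] {u : ℕ → L} {p : L → Prop}
    (h : ∀ N, ∃ i, N ≤ i ∧ p (u i)) : ∃ ℓ, p ℓ ∧ ∀ N, ∃ i, N ≤ i ∧ u i = ℓ := by
  by_contra! hc
  have hev : ∀ᶠ i in Filter.atTop, ∀ ℓ, p ℓ → u i ≠ ℓ := by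
    refine Filter.eventually_all.2 fun ℓ => ?_
    by_cases hℓ : p ℓ
    · obtain ⟨N, hN⟩ := hc ℓ hℓ
      exact Filter.eventually_atTop.2 ⟨N, fun i hi _ => hN i hi⟩
    · exact Filter.Eventually.of_forall fun i h => absurd h hℓ
  obtain ⟨N, hN⟩ := Filter.eventually_atTop.1 hev
  obtain ⟨i, hi, hpi⟩ := h N
  exact hN i hi _ hpi rfl

/-- A path in the transition graph of a tree-like OCATA cannot visit both the accepting and
the non-accepting locations infinitely often. -/
theorem IsTOCATA.not_alternating {A L : Type*} [Finite L] {Aut : OCATA A L} (hT : IsTOCATA Aut)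
    {u : ℕ → L} {a : ℕ → A} (hu : ∀ i, u (i + 1) ∈ (Aut.δ (u i) (a i)).locs)
    (h : ∀ N, ∃ i, N ≤ i ∧ u i ∈ Aut.final) (h' : ∀ N, ∃ i, N ≤ i ∧ u i ∉ Aut.final) :
    False := by
  obtain ⟨P, hP, hF, hanti, htrans⟩ := hT
  choose B hB _ using hP.2
  have hpath : ∀ i n, B (u (i + n)) = B (u i) ∨ BlockRel Aut (B (u (i + n))) (B (u i)) := by
    intro i n
    induction n with
    | zero => exact Or.inl rfl
    | succ n ih =>
      have hone : BlockRel Aut (B (u (i + (n + 1)))) (B (u (i + n))) :=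
        ⟨a (i + n), u (i + n), (hB _).2, u (i + (n + 1)), (hB _).2, hu (i + n)⟩
      rcases ih with ih | ih
      · exact Or.inr (ih ▸ hone)
      · exact htrans _ (hB _).1 _ (hB _).1 _ (hB _).1 hone ih
  have hpath' : ∀ i j, i ≤ j → B (u j) = B (u i) ∨ BlockRel Aut (B (u j)) (B (u i)) := by
    intro i j hij
    obtain ⟨n, rfl⟩ := Nat.exists_eq_add_of_le hij
    exact hpath i n
  obtain ⟨ℓ, hℓ, hinf⟩ := exists_frequently_eq h
  obtain ⟨i, -, hi⟩ := hinf 0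
  obtain ⟨j, hij, hj⟩ := h' i
  obtain ⟨k, hjk, hk⟩ := hinf j
  have hij' := hpath' i j hij
  have hjk' := hpath' j k hjk
  rw [hi] at hij'
  rw [hk] at hjk'
  have heq : B (u j) = B ℓ := by
    rcases hij' with e | e
    · exact e
    rcases hjk' with e' | e'
    · exact e'.symm
    exact hanti _ (hB _).1 _ (hB _).1 e e'
  rcases hF _ (hB ℓ).1 with hc | hc
  · exact hj (hc (heq ▸ (hB (u j)).2))
  · exact hc.subset ⟨(hB ℓ).2, hℓ⟩

/-- For every tree-like OCATA `A`, the dual automaton `A^C` accepts exactly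
the complement of the language of `A`: `L^ω(A^C) = TΣ^ω ∖ L^ω(A)`. -/
theorem tocata_dual_lang {A L : Type*} [Finite A] [Finite L] (Aut : OCATA A L)
    (hT : IsTOCATA Aut) :
    FLang Aut.dual IdApprox = Set.univ \ FLang Aut IdApprox := by
  ext θ
  constructor
  · rintro ⟨ρ', hρ'⟩
    refine ⟨trivial, ?_⟩
    rintro ⟨ρ, hρ⟩
    obtain ⟨β, hβ, hβ', hlocs⟩ := exists_common_branch ρ ρ'
    exact hT.not_alternating (u := fun i => (β i).1) hlocs (hρ β hβ) (hρ' β hβ')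
  · rintro ⟨-, hθ⟩
    exact (mem_FLang_or_mem_FLang_dual Aut θ).resolve_left hθ

end OcataPaper
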